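/- A lightcone framed curve (γ,ℓ⁺,ℓ⁻) : I → ℝ³₁ × Δ₄ with lightcone curvature (κ₁,κ₂,κ₃,α,β) is an (nˢ,n̄ˢ)-Bertrand lightcone framed curve if and only if there exist smooth functions λ, θ : I → ℝ with λ ≢ 0 such that λ(t)(κ₂(t)−κ₃(t))·cosh θ(t) + (α(t) + β(t) + λ(t)κ₁(t))·sinh θ(t) = 0 for all t ∈ I. -/

import Mathlib

open Matrix

noncomputable section

/-- The Minkowski pseudo-scalar product on `ℝ³`:
`⟨x,y⟩ = −x₁y₁ + x₂y₂ + x₃y₃`. -/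
def mdot (x y : Fin 3 → ℝ) : ℝ := -(x 0 * y 0) + x 1 * y 1 + x 2 * y 2

/-- The pseudo vector product `x ∧ y` on Minkowski `ℝ³`, i.e. the determinant of the
matrix with rows `(−e₁, e₂, e₃)`, `x`, `y`. -/
def mcross (x y : Fin 3 → ℝ) : Fin 3 → ℝ :=
  ![-(x 1 * y 2 - x 2 * y 1), x 2 * y 0 - x 0 * y 2, x 0 * y 1 - x 1 * y 0]

/-- The (punctured) lightcone `LC* = {x ≠ 0 : ⟨x,x⟩ = 0}`. -/
def LCstar (x : Fin 3 → ℝ) : Prop := x ≠ 0 ∧ mdot x x = 0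

/-- Membership in `Δ₄ = {(v,w) ∈ LC* × LC* : ⟨v,w⟩ = −2}`. -/
def MemDelta4 (v w : Fin 3 → ℝ) : Prop := LCstar v ∧ LCstar w ∧ mdot v w = -2

/-- `n(t) = −(1/2) ℓ⁺(t) ∧ ℓ⁻(t)`. -/
def lcn (lp lm : ℝ → Fin 3 → ℝ) : ℝ → Fin 3 → ℝ :=
  fun t => (-(1/2) : ℝ) • mcross (lp t) (lm t)

/-- Smoothness (on `I`) of a real valued function. -/
def Smooth1 (I : Set ℝ) (f : ℝ → ℝ) : Prop := ContDiffOn ℝ (⊤ : ℕ∞) f I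

/-- Smoothness (on `I`) of an `ℝ³`-valued function. -/
def Smooth3 (I : Set ℝ) (f : ℝ → Fin 3 → ℝ) : Prop := ContDiffOn ℝ (⊤ : ℕ∞) f I

/-- `λ ≢ 0` : the set where `λ` is non-zero is dense in `I`. -/
def NotIdentZero (I : Set ℝ) (f : ℝ → ℝ) : Prop :=
  I ⊆ closure {t | t ∈ I ∧ f t ≠ 0}

/-- A lightcone framed curve `(γ, ℓ⁺, ℓ⁻) : I → ℝ³₁ × Δ₄`. -/
structure IsLightconeFramedCurve (I : Set ℝ) (γ lp lm : ℝ → Fin 3 → ℝ) : Prop where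
  smooth_base : Smooth3 I γ
  smooth_lp : Smooth3 I lp
  smooth_lm : Smooth3 I lm
  delta4 : ∀ t ∈ I, MemDelta4 (lp t) (lm t)
  exists_coeffs : ∃ α β : ℝ → ℝ, Smooth1 I α ∧ Smooth1 I β ∧
    ∀ t ∈ I, deriv γ t = α t • lp t + β t • lm t

/-- `(κ₁, κ₂, κ₃, α, β)` is the lightcone curvature of the lightcone framed curve
`(γ, ℓ⁺, ℓ⁻)`. -/
structure HasLightconeCurvature (I : Set ℝ) (γ lp lm : ℝ → Fin 3 → ℝ)
    (κ₁ κ₂ κ₃ α β : ℝ → ℝ) : Prop where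
  smooth_κ₁ : Smooth1 I κ₁
  smooth_κ₂ : Smooth1 I κ₂
  smooth_κ₃ : Smooth1 I κ₃
  smooth_α : Smooth1 I α
  smooth_β : Smooth1 I β
  deriv_lp : ∀ t ∈ I, deriv lp t = κ₁ t • lp t + (2 * κ₃ t) • lcn lp lm t
  deriv_lm : ∀ t ∈ I, deriv lm t = (-κ₁ t) • lm t + (2 * κ₂ t) • lcn lp lm t
  deriv_n : ∀ t ∈ I, deriv (lcn lp lm) t = κ₂ t • lp t + κ₃ t • lm t
  deriv_base : ∀ t ∈ I, deriv γ t = α t • lp t + β t • lm t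

/-- The vector field `ℓ⁺` built from a lightcone frame. -/
def fieldLp (lp lm : ℝ → Fin 3 → ℝ) : ℝ → Fin 3 → ℝ := fun t => lp t
/-- The vector field `ℓ⁻` built from a lightcone frame. -/
def fieldLm (lp lm : ℝ → Fin 3 → ℝ) : ℝ → Fin 3 → ℝ := fun t => lm t
/-- `nᵀ = (ℓ⁺ + ℓ⁻)/2`. -/
def fieldNT (lp lm : ℝ → Fin 3 → ℝ) : ℝ → Fin 3 → ℝ := fun t => (1/2 : ℝ) • (lp t + lm t)
/-- `nˢ = (ℓ⁺ − ℓ⁻)/2`. -/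
def fieldNS (lp lm : ℝ → Fin 3 → ℝ) : ℝ → Fin 3 → ℝ := fun t => (1/2 : ℝ) • (lp t - lm t)
/-- `n = −(1/2) ℓ⁺ ∧ ℓ⁻`. -/
def fieldN (lp lm : ℝ → Fin 3 → ℝ) : ℝ → Fin 3 → ℝ := lcn lp lm
/-- `ℓ̃⁺ = nᵀ + n`. -/
def fieldLtp (lp lm : ℝ → Fin 3 → ℝ) : ℝ → Fin 3 → ℝ :=
  fun t => fieldNT lp lm t + fieldN lp lm t
/-- `ℓ̃⁻ = nᵀ − n`. -/
def fieldLtm (lp lm : ℝ → Fin 3 → ℝ) : ℝ → Fin 3 → ℝ :=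
  fun t => fieldNT lp lm t - fieldN lp lm t

/-- `(γ,ℓ⁺,ℓ⁻)` and `(γ̄,ℓ̄⁺,ℓ̄⁻)` are `(v,w̄)`-mates. -/
def AreMates (I : Set ℝ)
    (v w : (ℝ → Fin 3 → ℝ) → (ℝ → Fin 3 → ℝ) → ℝ → Fin 3 → ℝ)
    (γ lp lm γ' lp' lm' : ℝ → Fin 3 → ℝ) : Prop :=
  IsLightconeFramedCurve I γ lp lm ∧ IsLightconeFramedCurve I γ' lp' lm' ∧
  ∃ lam : ℝ → ℝ, Smooth1 I lam ∧ NotIdentZero I lam ∧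
    (∀ t ∈ I, γ' t = γ t + lam t • v lp lm t) ∧
    (∀ t ∈ I, v lp lm t = w lp' lm' t)

/-- `(γ,ℓ⁺,ℓ⁻)` is a `(v,w̄)`-Bertrand lightcone framed curve. -/
def IsBertrand (I : Set ℝ)
    (v w : (ℝ → Fin 3 → ℝ) → (ℝ → Fin 3 → ℝ) → ℝ → Fin 3 → ℝ)
    (γ lp lm : ℝ → Fin 3 → ℝ) : Prop :=
  ∃ γ' lp' lm' : ℝ → Fin 3 → ℝ, AreMates I v w γ lp lm γ' lp' lm'

theorem mdot_add_left (x y z : Fin 3 → ℝ) : mdot (x + y) z = mdot x z + mdot y z := by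
  simp only [mdot, Pi.add_apply]; ring

theorem mdot_smul_left (c : ℝ) (x y : Fin 3 → ℝ) : mdot (c • x) y = c * mdot x y := by
  simp only [mdot, Pi.smul_apply, smul_eq_mul]; ring

theorem mdot_sub_left (x y z : Fin 3 → ℝ) : mdot (x - y) z = mdot x z - mdot y z := by
  simp only [mdot, Pi.sub_apply]; ring

theorem mdot_comm (x y : Fin 3 → ℝ) : mdot x y = mdot y x := by
  simp only [mdot]; ring

theorem mdot_add_right (x y z : Fin 3 → ℝ) : mdot x (y + z) = mdot x y + mdot x z := by
  simp only [mdot, Pi.add_apply]; ring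

theorem mdot_sub_right (x y z : Fin 3 → ℝ) : mdot x (y - z) = mdot x y - mdot x z := by
  simp only [mdot, Pi.sub_apply]; ring

theorem mdot_smul_right (c : ℝ) (x y : Fin 3 → ℝ) : mdot x (c • y) = c * mdot x y := by
  simp only [mdot, Pi.smul_apply, smul_eq_mul]; ring

theorem mdot_mcross_left (x y : Fin 3 → ℝ) : mdot x (mcross x y) = 0 := by
  simp only [mdot, mcross, cons_val]; ring

theorem mdot_mcross_right (x y : Fin 3 → ℝ) : mdot y (mcross x y) = 0 := by
  simp only [mdot, mcross, cons_val]; ring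

theorem mdot_mcross_mcross (x y : Fin 3 → ℝ) :
    mdot (mcross x y) (mcross x y) = mdot x y ^ 2 - mdot x x * mdot y y := by
  simp only [mdot, mcross, cons_val]; ring

/-- The square of the triple product is minus the Gram determinant. -/
theorem mdot_mcross_sq (v x y : Fin 3 → ℝ) :
    mdot v (mcross x y) ^ 2 =
      -(mdot v v * (mdot x x * mdot y y - mdot x y ^ 2)
        - mdot v x * (mdot v x * mdot y y - mdot x y * mdot v y)
        + mdot v y * (mdot v x * mdot x y - mdot x x * mdot v y)) := by
  simp only [mdot, mcross, cons_val]; ring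

/-- The moving frame `nᵀ, nˢ, n` is pseudo-orthonormal. -/
theorem MemDelta4.frame {lp lm : ℝ → Fin 3 → ℝ} {t : ℝ} (h : MemDelta4 (lp t) (lm t)) :
    mdot (fieldNT lp lm t) (fieldNT lp lm t) = -1 ∧
    mdot (fieldNS lp lm t) (fieldNS lp lm t) = 1 ∧
    mdot (lcn lp lm t) (lcn lp lm t) = 1 ∧
    mdot (fieldNT lp lm t) (fieldNS lp lm t) = 0 ∧
    mdot (fieldNT lp lm t) (lcn lp lm t) = 0 ∧
    mdot (fieldNS lp lm t) (lcn lp lm t) = 0 := by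
  obtain ⟨⟨-, hp⟩, ⟨-, hm⟩, hpm⟩ := h
  have hmp := mdot_comm (lp t) (lm t)
  simp only [fieldNT, fieldNS, lcn, mdot_add_left, mdot_sub_left, mdot_smul_left, mdot_add_right,
    mdot_sub_right, mdot_smul_right, mdot_mcross_left, mdot_mcross_right, mdot_mcross_mcross,
    ← hmp, hp, hm, hpm]
  norm_num

/-- Components of a unit timelike vector orthogonal to `nˢ`. -/
theorem MemDelta4.sq_sub_sq {lp lm : ℝ → Fin 3 → ℝ} {t : ℝ} (h : MemDelta4 (lp t) (lm t))
    {v : Fin 3 → ℝ} (hv : mdot v v = -1) (hS : mdot v (fieldNS lp lm t) = 0) :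
    mdot v (fieldNT lp lm t) ^ 2 - mdot v (lcn lp lm t) ^ 2 = 1 := by
  obtain ⟨⟨-, hp⟩, ⟨-, hm⟩, hpm⟩ := h
  have key := mdot_mcross_sq v (lp t) (lm t)
  rw [hp, hm, hpm, hv] at key
  simp only [fieldNT, fieldNS, lcn, mdot_add_right, mdot_sub_right, mdot_smul_right] at hS ⊢
  linear_combination (-1 / 4) * key + (1 / 2) * (mdot v (lp t) - mdot v (lm t)) * hS

/-- Vectors `x ± y`, with `x` unit timelike, `y` unit spacelike and orthogonal, form a null pair. -/
theorem memDelta4_add_sub {x y : Fin 3 → ℝ} (hx : mdot x x = -1) (hy : mdot y y = 1)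
    (hxy : mdot x y = 0) : MemDelta4 (x + y) (x - y) := by
  have hyx := mdot_comm x y
  have hpm : mdot (x + y) (x - y) = -2 := by
    simp only [mdot_add_left, mdot_sub_right]; linarith
  refine ⟨⟨fun h0 => ?_, ?_⟩, ⟨fun h0 => ?_, ?_⟩, hpm⟩
  · rw [h0] at hpm; norm_num [mdot] at hpm
  · simp only [mdot_add_left, mdot_add_right]; linarith
  · rw [h0] at hpm; norm_num [mdot] at hpm
  · simp only [mdot_sub_left, mdot_sub_right]; linarith

section Smoothness

variable {I : Set ℝ} {f : ℝ → ℝ} {x y lp lm : ℝ → Fin 3 → ℝ}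

theorem Smooth3.apply (hx : Smooth3 I x) (i : Fin 3) : Smooth1 I fun t => x t i :=
  contDiffOn_pi.1 hx i

theorem Smooth3.mdot (hx : Smooth3 I x) (hy : Smooth3 I y) :
    Smooth1 I fun t => mdot (x t) (y t) :=
  (((hx.apply 0).mul (hy.apply 0)).neg.add ((hx.apply 1).mul (hy.apply 1))).add
    ((hx.apply 2).mul (hy.apply 2))

theorem Smooth3.lcn (hx : Smooth3 I x) (hy : Smooth3 I y) : Smooth3 I (lcn x y) := by
  refine ContDiffOn.const_smul (-(1/2) : ℝ) (contDiffOn_pi.2 fun i => ?_)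
  fin_cases i
  · exact (((hx.apply 1).mul (hy.apply 2)).sub ((hx.apply 2).mul (hy.apply 1))).neg
  · exact ((hx.apply 2).mul (hy.apply 0)).sub ((hx.apply 0).mul (hy.apply 2))
  · exact ((hx.apply 0).mul (hy.apply 1)).sub ((hx.apply 1).mul (hy.apply 0))

theorem Smooth3.fieldNT (hx : Smooth3 I x) (hy : Smooth3 I y) : Smooth3 I (fieldNT x y) :=
  ContDiffOn.const_smul (1/2 : ℝ) (ContDiffOn.add hx hy)

theorem Smooth3.fieldNS (hx : Smooth3 I x) (hy : Smooth3 I y) : Smooth3 I (fieldNS x y) :=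
  ContDiffOn.const_smul (1/2 : ℝ) (ContDiffOn.sub hx hy)

theorem Smooth3.hasDerivAt (hI : IsOpen I) (hx : Smooth3 I x) {t : ℝ} (ht : t ∈ I) :
    HasDerivAt x (deriv x t) t :=
  ((ContDiffOn.differentiableOn hx (by simp)).differentiableAt (hI.mem_nhds ht)).hasDerivAt

theorem Smooth1.hasDerivAt (hI : IsOpen I) (hf : Smooth1 I f) {t : ℝ} (ht : t ∈ I) :
    HasDerivAt f (deriv f t) t :=
  ((ContDiffOn.differentiableOn hf (by simp)).differentiableAt (hI.mem_nhds ht)).hasDerivAt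

theorem Smooth1.deriv (hI : IsOpen I) (hf : Smooth1 I f) : Smooth1 I (deriv f) :=
  ContDiffOn.deriv_of_isOpen hf hI (by simp)

end Smoothness

/-- The velocity of a curve displaced along `nˢ`, in the frame `nᵀ, n, nˢ`. -/
theorem deriv_add_smul_fieldNS {I : Set ℝ} (hI : IsOpen I) {γ lp lm δ : ℝ → Fin 3 → ℝ}
    {κ₁ κ₂ κ₃ α β lam : ℝ → ℝ} (hF : IsLightconeFramedCurve I γ lp lm)
    (hC : HasLightconeCurvature I γ lp lm κ₁ κ₂ κ₃ α β) (hlam : Smooth1 I lam)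
    (hδ : ∀ t ∈ I, δ t = γ t + lam t • fieldNS lp lm t) {t : ℝ} (ht : t ∈ I) :
    deriv δ t = (α t + β t + lam t * κ₁ t) • fieldNT lp lm t
      + (lam t * (κ₃ t - κ₂ t)) • lcn lp lm t
      + (α t - β t + deriv lam t) • fieldNS lp lm t := by
  have hev : δ =ᶠ[nhds t] fun s => γ s + lam s • fieldNS lp lm s := by
    filter_upwards [hI.mem_nhds ht] with s hs using hδ s hs
  have hS : HasDerivAt (fieldNS lp lm) ((1 / 2 : ℝ) • (deriv lp t - deriv lm t)) t :=
    ((hF.smooth_lp.hasDerivAt hI ht).sub (hF.smooth_lm.hasDerivAt hI ht)).const_smul (1 / 2 : ℝ)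
  have h : HasDerivAt (fun s => γ s + lam s • fieldNS lp lm s) _ t :=
    (hF.smooth_base.hasDerivAt hI ht).add ((hlam.hasDerivAt hI ht).smul hS)
  rw [hev.deriv_eq, h.deriv, hC.deriv_base t ht, hC.deriv_lp t ht, hC.deriv_lm t ht]
  simp only [fieldNT, fieldNS]
  module

/-- A point of the hyperbola `a² - b² = 1` has hyperbolic angle `log |a + b|`, up to sign. -/
theorem exists_sign_cosh_sinh_log {a b : ℝ} (h : a ^ 2 - b ^ 2 = 1) :
    ∃ ε : ℝ, Real.cosh (Real.log (a + b)) = ε * a ∧ Real.sinh (Real.log (a + b)) = ε * b := by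
  have hmul : (a + b) * (a - b) = 1 := by linear_combination h
  have hinv : (a + b)⁻¹ = a - b := inv_eq_of_mul_eq_one_right hmul
  rcases lt_or_gt_of_ne (left_ne_zero_of_mul_eq_one hmul) with hneg | hpos
  · refine ⟨-1, ?_, ?_⟩
    · rw [← Real.log_neg_eq_log, Real.cosh_log (neg_pos.2 hneg), inv_neg, hinv]; ring
    · rw [← Real.log_neg_eq_log, Real.sinh_log (neg_pos.2 hneg), inv_neg, hinv]; ring
  · refine ⟨1, ?_, ?_⟩
    · rw [Real.cosh_log hpos, hinv]; ring
    · rw [Real.sinh_log hpos, hinv]; ring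

/-- `(nˢ,n̄ˢ)`-Bertrand lightcone framed curves: existence condition. -/
theorem bertrand_nS_nSbar
    (I : Set ℝ) (hIo : IsOpen I) (hIc : I.OrdConnected)
    (γ lp lm : ℝ → Fin 3 → ℝ) (κ₁ κ₂ κ₃ α β : ℝ → ℝ)
    (hF : IsLightconeFramedCurve I γ lp lm)
    (hC : HasLightconeCurvature I γ lp lm κ₁ κ₂ κ₃ α β) :
    IsBertrand I fieldNS fieldNS γ lp lm ↔
      ∃ lam θ : ℝ → ℝ, Smooth1 I lam ∧ Smooth1 I θ ∧ NotIdentZero I lam ∧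
        ∀ t ∈ I, lam t * (κ₂ t - κ₃ t) * Real.cosh (θ t) +
          (α t + β t + lam t * κ₁ t) * Real.sinh (θ t) = 0 := by
  constructor
  · rintro ⟨δ, lp', lm', -, hF', lam, hlam, hne, hδ, hS⟩
    obtain ⟨α', β', -, -, hd⟩ := hF'.exists_coeffs
    have hsq : ∀ t ∈ I, mdot (fieldNT lp' lm' t) (fieldNT lp lm t) ^ 2
        - mdot (fieldNT lp' lm' t) (lcn lp lm t) ^ 2 = 1 := fun t ht => by
      obtain ⟨hTT, -, -, hTS, -, -⟩ := (hF'.delta4 t ht).frame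
      exact (hF.delta4 t ht).sq_sub_sq hTT (by rw [hS t ht, hTS])
    have hT' := hF'.smooth_lp.fieldNT hF'.smooth_lm
    refine ⟨lam, fun t => Real.log (-mdot (fieldNT lp' lm' t) (fieldNT lp lm t)
      + mdot (fieldNT lp' lm' t) (lcn lp lm t)), hlam, ?_, hne, fun t ht => ?_⟩
    · refine ContDiffOn.log ((hT'.mdot (hF.smooth_lp.fieldNT hF.smooth_lm)).neg.add
        (hT'.mdot (hF.smooth_lp.lcn hF.smooth_lm))) fun t ht h0 => ?_
      have := hsq t ht
      rw [neg_add_eq_zero] at h0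
      simp [h0] at this
    · obtain ⟨ε, hc, hs⟩ := exists_sign_cosh_sinh_log
        (a := -mdot (fieldNT lp' lm' t) (fieldNT lp lm t))
        (b := mdot (fieldNT lp' lm' t) (lcn lp lm t)) (by rw [neg_sq]; exact hsq t ht)
      obtain ⟨hTT, -, hnn, hTS, hTn, hSn⟩ := (hF.delta4 t ht).frame
      have hd' : deriv δ t = (α' t + β' t) • fieldNT lp' lm' t
          + (α' t - β' t) • fieldNS lp lm t := by
        rw [hd t ht, hS t ht]; simp only [fieldNT, fieldNS]; module
      rw [deriv_add_smul_fieldNS hIo hF hC hlam hδ ht] at hd'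
      have hA := congrArg (fun v => mdot v (fieldNT lp lm t)) hd'
      have hB := congrArg (fun v => mdot v (lcn lp lm t)) hd'
      have hST := mdot_comm (fieldNT lp lm t) (fieldNS lp lm t)
      have hnT := mdot_comm (fieldNT lp lm t) (lcn lp lm t)
      simp only [mdot_add_left, mdot_smul_left, hTT, hnn, hTn, hSn, ← hST, ← hnT, hTS] at hA hB
      rw [hc, hs]
      linear_combination ε * mdot (fieldNT lp' lm' t) (fieldNT lp lm t) * hB
        - ε * mdot (fieldNT lp' lm' t) (lcn lp lm t) * hA
  · rintro ⟨lam, θ, hlam, hθ, hne, heq⟩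
    have hsT := hF.smooth_lp.fieldNT hF.smooth_lm
    have hsS := hF.smooth_lp.fieldNS hF.smooth_lm
    have hsn := hF.smooth_lp.lcn hF.smooth_lm
    have hch : Smooth1 I fun t => Real.cosh (θ t) := ContDiffOn.cosh hθ
    have hsh : Smooth1 I fun t => Real.sinh (θ t) := ContDiffOn.sinh hθ
    set T : ℝ → Fin 3 → ℝ :=
      fun t => Real.cosh (θ t) • fieldNT lp lm t + Real.sinh (θ t) • lcn lp lm t with hT
    have hsT' : Smooth3 I T :=
      ContDiffOn.add (ContDiffOn.smul hch hsT) (ContDiffOn.smul hsh hsn)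
    set A : ℝ → ℝ := fun t => α t + β t + lam t * κ₁ t with hA
    set B : ℝ → ℝ := fun t => lam t * (κ₃ t - κ₂ t) with hB
    set C : ℝ → ℝ := fun t => α t - β t + deriv lam t with hCdef
    have hsA : Smooth1 I A := (hC.smooth_α.add hC.smooth_β).add (hlam.mul hC.smooth_κ₁)
    have hsB : Smooth1 I B := hlam.mul (hC.smooth_κ₃.sub hC.smooth_κ₂)
    have hsC : Smooth1 I C := (hC.smooth_α.sub hC.smooth_β).add (hlam.deriv hIo)
    have hss : Smooth1 I fun t => A t * Real.cosh (θ t) - B t * Real.sinh (θ t) :=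
      (hsA.mul hch).sub (hsB.mul hsh)
    refine ⟨fun t => γ t + lam t • fieldNS lp lm t, fun t => T t + fieldNS lp lm t,
      fun t => T t - fieldNS lp lm t, hF, ⟨?_, ?_, ?_, fun t ht => ?_, ?_⟩, lam, hlam, hne,
      fun t _ => rfl, fun t _ => ?_⟩
    · exact ContDiffOn.add hF.smooth_base (ContDiffOn.smul hlam hsS)
    · exact ContDiffOn.add hsT' hsS
    · exact ContDiffOn.sub hsT' hsS
    · obtain ⟨hTT, hSS, hnn, hTS, hTn, hSn⟩ := (hF.delta4 t ht).frame
      have hnS := mdot_comm (fieldNS lp lm t) (lcn lp lm t)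
      have hnT := mdot_comm (fieldNT lp lm t) (lcn lp lm t)
      refine memDelta4_add_sub ?_ hSS ?_
      · simp only [hT, mdot_add_left, mdot_add_right, mdot_smul_left, mdot_smul_right, hTT, hnn,
          hTn, ← hnT]
        linear_combination -Real.cosh_sq_sub_sinh_sq (θ t)
      · simp only [hT, mdot_add_left, mdot_smul_left, hTS, ← hnS, hSn]
        ring
    · refine ⟨fun t => (1 / 2) * (A t * Real.cosh (θ t) - B t * Real.sinh (θ t) + C t),
        fun t => (1 / 2) * (A t * Real.cosh (θ t) - B t * Real.sinh (θ t) - C t),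
        contDiffOn_const.mul (hss.add hsC), contDiffOn_const.mul (hss.sub hsC), fun t ht => ?_⟩
      rw [deriv_add_smul_fieldNS hIo hF hC hlam (fun _ _ => rfl) ht]
      have h1 := Real.cosh_sq_sub_sinh_sq (θ t)
      have h2 : A t * Real.sinh (θ t) = B t * Real.cosh (θ t) := by
        simp only [hA, hB]; linear_combination heq t ht
      have hAt : A t = (A t * Real.cosh (θ t) - B t * Real.sinh (θ t)) * Real.cosh (θ t) := by
        linear_combination -A t * h1 - Real.sinh (θ t) * h2
      have hBt : B t = (A t * Real.cosh (θ t) - B t * Real.sinh (θ t)) * Real.sinh (θ t) := by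
        linear_combination -B t * h1 - Real.cosh (θ t) * h2
      change A t • fieldNT lp lm t + B t • lcn lp lm t + C t • fieldNS lp lm t = _
      beta_reduce
      generalize A t * Real.cosh (θ t) - B t * Real.sinh (θ t) = s at hAt hBt ⊢
      rw [hAt, hBt]
      simp only [hT]
      module
    · simp only [fieldNS]
      module
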